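/- arXiv:2605.28466 — 2 statements merged into one kernel-verified Lean document; each statement's English description precedes it below -/
import Mathlib

section
/- Let K and S be compact Hausdorff spaces, μ : S → M(K) weak-star continuous, U ⊂ S a nonempty open set, 1/2 < r < 1, and M := sup_{s∈S} ‖μ(s)‖. Suppose there exists ε > 0 such that Re μ(s)(K) > M − ε for every s ∈ U. Then there exist a weak-star continuous map μ' : S → M(K) with ‖μ'‖ ≤ M and a nonempty open set U' ⊂ U such that Re μ'(s)(K) > ‖μ'‖ − rε for every s ∈ U', and ‖μ' − μ‖ ≤ sqrt(2Mε) + 2ε. -/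
open Complex

lemma ContinuousLinearMap.opNorm_le_of_re_le {E : Type*} [NormedAddCommGroup E] [NormedSpace ℂ E]
    (φ : E →L[ℂ] ℂ) {C : ℝ} (h : ∀ x, ‖x‖ ≤ 1 → (φ x).re ≤ C) : ‖φ‖ ≤ C := by
  have hC : 0 ≤ C := by simpa using h 0 (by simp)
  refine φ.opNorm_le_of_unit_norm (𝕜 := ℂ) hC fun x hx => ?_
  obtain ⟨u, hu, hux⟩ := RCLike.exists_norm_mul_eq_self (φ x)
  have hu0 : u ≠ 0 := by rintro rfl; simp at hu
  have hre : φ (u⁻¹ • x) = (‖φ x‖ : ℂ) := by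
    rw [map_smul, smul_eq_mul, inv_mul_eq_iff_eq_mul₀ hu0]
    exact hux.symm
  have := h (u⁻¹ • x) (by rw [norm_smul, norm_inv, hu, hx]; simp)
  rwa [hre, ofReal_re] at this

lemma Complex.norm_add_mul_one_sub_mul_re_le {z : ℂ} (hz : ‖z‖ ≤ 1) {τ : ℝ} (hτ : 0 ≤ τ)
    (hτ' : τ ≤ 1 / 2) : ‖z + τ * (1 - z * z.re)‖ ≤ 1 + 2 * τ ^ 2 := by
  have hz2 : z.re ^ 2 + z.im ^ 2 ≤ 1 := by
    have := Complex.sq_norm z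
    rw [normSq_apply] at this
    nlinarith [norm_nonneg z]
  have hre := (abs_le.1 ((abs_re_le_norm z).trans hz)).2
  have hw : ‖1 - z * z.re‖ ≤ 2 := by
    calc ‖1 - z * z.re‖ ≤ ‖(1 : ℂ)‖ + ‖z * z.re‖ := norm_sub_le _ _
      _ ≤ 1 + 1 * 1 := by
        rw [norm_one, norm_mul, norm_real, Real.norm_eq_abs]
        gcongr
        exact (abs_re_le_norm z).trans hz
      _ = 2 := by norm_num
  have hw2 : normSq (1 - z * z.re) ≤ 4 := by
    rw [← Complex.sq_norm]; nlinarith [norm_nonneg (1 - z * z.re)]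
  refine abs_le_of_sq_le_sq' ?_ (by positivity) |>.2
  rw [Complex.sq_norm]
  rw [normSq_apply] at hw2 ⊢
  simp only [add_re, add_im, mul_re, mul_im, sub_re, sub_im, one_re, one_im, ofReal_re,
    ofReal_im] at hw2 ⊢
  have h1 : 0 ≤ (1 - (z.re ^ 2 + z.im ^ 2)) * (1 - 2 * τ * z.re) :=
    mul_nonneg (by linarith) (by nlinarith)
  have h2 := mul_le_mul_of_nonneg_left hw2 (sq_nonneg τ)
  nlinarith [sq_nonneg (τ ^ 2)]

lemma Complex.norm_mul_one_sub_add_le {z y : ℂ} (hz : ‖z‖ ≤ 1) (hy : ‖y‖ ≤ 1) {c : ℝ}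
    (hc : 0 ≤ c) :
    ‖z - (1 / 2 : ℂ) * (z - z * z.re) + (c / 2 : ℝ) * ((z - 1) * y)‖ ≤ 1 + c ^ 2 / 4 := by
  have hre := abs_le.1 ((abs_re_le_norm z).trans hz)
  have h1 : ‖z - (1 / 2 : ℂ) * (z - z * z.re)‖ ≤ (1 + z.re) / 2 := by
    have : z - (1 / 2 : ℂ) * (z - z * z.re) = z * (((1 + z.re) / 2 : ℝ) : ℂ) := by
      push_cast; ring
    rw [this, norm_mul, norm_real, Real.norm_of_nonneg (by linarith)]
    exact mul_le_of_le_one_left (by linarith) hz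
  have h2 : ‖z - 1‖ ^ 2 ≤ 2 * (1 - z.re) := by
    have hz2 := Complex.sq_norm z
    rw [Complex.sq_norm, normSq_apply]
    rw [normSq_apply] at hz2
    simp only [sub_re, sub_im, one_re, one_im]
    nlinarith [norm_nonneg z]
  have h3 : ‖((c / 2 : ℝ) : ℂ) * ((z - 1) * y)‖ ≤ c / 2 * ‖z - 1‖ := by
    rw [norm_mul, norm_mul, norm_real, Real.norm_of_nonneg (by positivity)]
    gcongr
    exact mul_le_of_le_one_right (norm_nonneg _) hy
  refine (norm_add_le _ _).trans ?_
  nlinarith [sq_nonneg (‖z - 1‖ - c)]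

section NearlyNorming

variable {K : Type*} [TopologicalSpace K] [CompactSpace K]

lemma ContinuousMap.re_apply_le_of_norm_le (φ : C(K, ℂ) →L[ℂ] ℂ) {A B : ℝ} (hφ : ‖φ‖ ≤ A)
    (hB : 0 ≤ B) {w : C(K, ℂ)} (hw : ∀ x, ‖w x‖ ≤ B) : (φ w).re ≤ A * B :=
  (re_le_norm _).trans <| (φ.le_opNorm w).trans <|
    mul_le_mul hφ ((ContinuousMap.norm_le w hB).2 hw) (norm_nonneg _) ((norm_nonneg _).trans hφ)

/-- If `f` nearly norms `φ` and `1` norms it up to `ε`, then multiplication of `φ` by `f`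
moves `φ` by at most about `A * c / 2 + ε / c`. -/
lemma ContinuousMap.re_apply_sub_one_mul_le (φ : C(K, ℂ) →L[ℂ] ℂ) {A ε τ c : ℝ} (hφ : ‖φ‖ ≤ A)
    (hone : A - ε ≤ (φ 1).re) (hτ : 0 < τ) (hτ' : τ ≤ 1 / 2) (hc : 0 < c) {f : C(K, ℂ)}
    (hf : ‖f‖ ≤ 1) (hφf : A - τ ^ 2 ≤ (φ f).re) {h : C(K, ℂ)} (hh : ‖h‖ ≤ 1) :
    (φ ((f - 1) * h)).re ≤ A * c / 2 + ε / c + (2 + 2 * A) * τ / c := by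
  have hA : 0 ≤ A := (norm_nonneg _).trans hφ
  have hfx x : ‖f x‖ ≤ 1 := (f.norm_coe_le_norm x).trans hf
  let q : C(K, ℂ) := f * ⟨fun x => ((f x).re : ℂ), by fun_prop⟩
  have hqx x : q x = f x * (f x).re := rfl
  have hfA : (φ f).re ≤ A * 1 := re_apply_le_of_norm_le φ hφ zero_le_one hfx
  have h1 := re_apply_le_of_norm_le φ hφ (B := 1 + 2 * τ ^ 2) (by positivity)
    (w := f + (τ : ℂ) • (1 - q))
    fun x => by simpa [hqx] using norm_add_mul_one_sub_mul_re_le (hfx x) hτ.le hτ'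
  have h2 := re_apply_le_of_norm_le φ hφ (B := 1 + c ^ 2 / 4) (by positivity)
    (w := f - ((1 / 2 : ℝ) : ℂ) • (f - q) + ((c / 2 : ℝ) : ℂ) • ((f - 1) * h))
    fun x => by
      simpa [hqx] using norm_mul_one_sub_add_le (hfx x) ((h.norm_coe_le_norm x).trans hh) hc.le
  simp only [map_add, map_sub, map_smul, smul_eq_mul, add_re, sub_re, re_ofReal_mul] at h1 h2
  have h3 : (φ 1).re - (φ q).re ≤ τ + 2 * A * τ := by
    refine le_of_mul_le_mul_left ?_ hτ
    nlinarith
  set X := (φ ((f - 1) * h)).re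
  have h4 : c * X ≤ A * c ^ 2 / 2 + ε + (2 + 2 * A) * τ := by nlinarith
  have h5 : A * c / 2 + ε / c + (2 + 2 * A) * τ / c
      = (A * c ^ 2 / 2 + ε + (2 + 2 * A) * τ) / c := by field_simp
  rw [h5, le_div_iff₀ hc]
  linarith

end NearlyNorming

lemma bddAbove_range_norm_of_continuous_apply {S E : Type*} [TopologicalSpace S] [CompactSpace S]
    [NormedAddCommGroup E] [NormedSpace ℂ E] [CompleteSpace E] {μ : S → E →L[ℂ] ℂ}
    (hμ : ∀ x, Continuous fun s => μ s x) : BddAbove (Set.range fun s => ‖μ s‖) := by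
  obtain ⟨C, hC⟩ := banach_steinhaus (g := μ) fun x => by
    obtain ⟨C, hC⟩ := (isCompact_range (hμ x).norm).bddAbove
    exact ⟨C, fun s => hC ⟨s, rfl⟩⟩
  exact ⟨C, Set.forall_mem_range.2 hC⟩

/-- Defect-reduction lemma.  Let `K` and `S` be compact Hausdorff spaces, `μ : S → M(K)`
weak-star continuous (with `M(K) = C(K)*` realized as the dual of `C(K, ℂ)`, the dual norm
being the total variation norm and `μ(s)(K) = μ(s)(1)`), `U ⊆ S` a nonempty open set,
`1/2 < r < 1`, and `M := sup_{s∈S} ‖μ(s)‖`.  If there exists `ε > 0` such that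
`Re μ(s)(K) > M − ε` for every `s ∈ U`, then there exist a weak-star continuous
`μ' : S → M(K)` with `‖μ'‖ ≤ M` and a nonempty open `U' ⊆ U` such that
`Re μ'(s)(K) > ‖μ'‖ − rε` for every `s ∈ U'`, and `‖μ' − μ‖ ≤ sqrt(2Mε) + 2ε`. -/
theorem defect_reduction
    {K S : Type*} [TopologicalSpace K] [CompactSpace K] [T2Space K]
    [TopologicalSpace S] [CompactSpace S] [T2Space S] [Nonempty S]
    (μ : S → (C(K, ℂ) →L[ℂ] ℂ)) (hμ : ∀ f : C(K, ℂ), Continuous fun s => μ s f)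
    (U : Set S) (hU : IsOpen U) (hUne : U.Nonempty)
    (r : ℝ) (hr : 1 / 2 < r) (hr1 : r < 1)
    (ε : ℝ) (hε : 0 < ε)
    (hdef : ∀ s ∈ U, (μ s 1).re > (⨆ s' : S, ‖μ s'‖) - ε) :
    ∃ (μ' : S → (C(K, ℂ) →L[ℂ] ℂ)) (U' : Set S),
      (∀ f : C(K, ℂ), Continuous fun s => μ' s f) ∧
      (⨆ s : S, ‖μ' s‖) ≤ (⨆ s : S, ‖μ s‖) ∧
      IsOpen U' ∧ U'.Nonempty ∧ U' ⊆ U ∧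
      (∀ s ∈ U', (μ' s 1).re > (⨆ s' : S, ‖μ' s'‖) - r * ε) ∧
      (⨆ s : S, ‖μ' s - μ s‖) ≤ Real.sqrt (2 * (⨆ s' : S, ‖μ s'‖) * ε) + 2 * ε := by
  have hbdd := bddAbove_range_norm_of_continuous_apply hμ
  set M := ⨆ s : S, ‖μ s‖ with hM
  have hle s : ‖μ s‖ ≤ M := le_ciSup hbdd s
  obtain ⟨s₁, hs₁⟩ := hUne
  rcases ((norm_nonneg _).trans (hle s₁)).eq_or_lt with hM0 | hM0
  · have hz s : μ s = 0 := norm_le_zero_iff (a := μ s) |>.1 ((hle s).trans hM0.ge)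
    refine ⟨μ, U, hμ, le_rfl, hU, ⟨s₁, hs₁⟩, subset_rfl, fun s _ => ?_, ?_⟩
    · rw [← hM, ← hM0, hz s]
      have : 0 < r * ε := by positivity
      simpa using this
    · simp only [sub_self, norm_zero, ciSup_const]
      positivity
  have : Nonempty K := by
    by_contra hK
    rw [not_nonempty_iff] at hK
    have hz s : μ s = 0 := by
      ext f
      rw [Subsingleton.elim f 0, map_zero, map_zero]
    simp [hM, hz] at hM0
  obtain ⟨x₀⟩ := this
  set A := sSup ((fun s => ‖μ s‖) '' U)
  have hbddU : BddAbove ((fun s => ‖μ s‖) '' U) := hbdd.mono (Set.image_subset_range _ _)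
  have hleA s (hs : s ∈ U) : ‖μ s‖ ≤ A := le_csSup hbddU ⟨s, hs, rfl⟩
  have hAM : A ≤ M := csSup_le ⟨_, s₁, hs₁, rfl⟩ (Set.forall_mem_image.2 fun s _ => hle s)
  have hA0 : 0 ≤ A := (norm_nonneg _).trans (hleA s₁ hs₁)
  have hnorm1 : ∀ x : K, ‖(1 : C(K, ℂ)) x‖ ≤ 1 := fun x => by simp
  have hMA : M - ε < A := by
    have := ContinuousMap.re_apply_le_of_norm_le (μ s₁) (hleA s₁ hs₁) zero_le_one hnorm1
    linarith [hdef s₁ hs₁]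
  set c := √(2 * ε / M)
  have hc0 : 0 < c := by positivity
  have hcsq : c ^ 2 = 2 * ε / M := Real.sq_sqrt (by positivity)
  have hMc : M * c / 2 + ε / c = √(2 * M * ε) := by
    have h1 : M * c ^ 2 = 2 * ε := by rw [hcsq]; field_simp
    have h2 : √(2 * M * ε) = M * c := by
      rw [show 2 * M * ε = (M * c) ^ 2 by linear_combination -M * h1]
      exact Real.sqrt_sq (by positivity)
    rw [h2]
    field_simp
    linarith
  obtain ⟨τ, hτ0, hτ1, hτε, hτc⟩ :
      ∃ τ : ℝ, 0 < τ ∧ τ ≤ 1 / 2 ∧ τ ≤ ε ∧ (2 + 2 * M) * τ ≤ ε * c := by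
    refine ⟨min (1 / 2) (min ε (ε * c / (2 + 2 * M))), by positivity, min_le_left _ _,
      (min_le_right _ _).trans (min_le_left _ _), ?_⟩
    rw [← le_div_iff₀' (by positivity)]
    exact (min_le_right _ _).trans (min_le_right _ _)
  have hτr : τ ^ 2 < r * ε := by nlinarith
  obtain ⟨s₀, hs₀, f, hf, hfs₀⟩ : ∃ s₀ ∈ U, ∃ f : C(K, ℂ), ‖f‖ ≤ 1 ∧
      A - τ ^ 2 < (μ s₀ f).re := by
    by_contra! hcon
    have : A ≤ A - τ ^ 2 := csSup_le ⟨_, s₁, hs₁, rfl⟩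
      (Set.forall_mem_image.2 fun s hs => (μ s).opNorm_le_of_re_le (hcon s hs))
    nlinarith
  set V := U ∩ {s | A - τ ^ 2 < (μ s f).re}
  have hVo : IsOpen V :=
    hU.inter (isOpen_lt continuous_const (continuous_re.comp (hμ f)))
  obtain ⟨g, hg0, hg1, hg⟩ := exists_continuous_zero_one_of_isClosed hVo.isClosed_compl
    (isClosed_singleton (x := s₀))
    (Set.disjoint_singleton_right.2 fun h => h ⟨hs₀, hfs₀⟩)
  have hgs₀ : g s₀ = 1 := hg1 rfl
  let ν (s : S) : C(K, ℂ) →L[ℂ] ℂ := (μ s).comp (ContinuousLinearMap.mul ℂ C(K, ℂ) (f - 1)) +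
    ((M - A : ℝ) : ℂ) • ContinuousMap.evalCLM ℂ x₀
  have hν s h : ν s h = μ s ((f - 1) * h) + ((M - A : ℝ) : ℂ) * h x₀ := rfl
  let μ' (s : S) : C(K, ℂ) →L[ℂ] ℂ := μ s + (g s : ℂ) • ν s
  have hμ' s h : μ' s h = μ s h + (g s : ℂ) * (μ s ((f - 1) * h) + ((M - A : ℝ) : ℂ) * h x₀) := rfl
  have hcont h : Continuous fun s => μ' s h := by
    simp only [hμ']
    have h1 := hμ h
    have h2 := hμ ((f - 1) * h)
    fun_prop
  have hout s (hs : s ∉ V) : g s = 0 := hg0 hs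
  have heval {h : C(K, ℂ)} (hh : ‖h‖ ≤ 1) : (((M - A : ℝ) : ℂ) * h x₀).re ≤ M - A := by
    rw [re_ofReal_mul]
    exact mul_le_of_le_one_right (by linarith)
      ((re_le_norm _).trans ((h.norm_coe_le_norm x₀).trans hh))
  have hnorm s : ‖μ' s‖ ≤ M := by
    by_cases hs : s ∈ V
    · refine ContinuousLinearMap.opNorm_le_of_re_le _ fun h hh => ?_
      have hw : (μ s (h + (g s : ℂ) • ((f - 1) * h))).re ≤ A * 1 := by
        refine ContinuousMap.re_apply_le_of_norm_le _ (hleA s hs.1) zero_le_one fun x => ?_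
        have hfx := (f.norm_coe_le_norm x).trans hf
        have hhx := (h.norm_coe_le_norm x).trans hh
        have : (h + (g s : ℂ) • ((f - 1) * h)) x
            = (((1 - g s : ℝ) : ℂ) + (g s : ℂ) * f x) * h x := by
          simp; ring
        rw [this, norm_mul]
        refine mul_le_one₀ ((norm_add_le _ _).trans ?_) (norm_nonneg _) hhx
        rw [norm_mul, norm_real, norm_real, Real.norm_of_nonneg (hg s).1,
          Real.norm_of_nonneg (by linarith [(hg s).2])]
        nlinarith [(hg s).1]
      rw [hμ']
      simp only [map_add, map_smul, smul_eq_mul, add_re, re_ofReal_mul, mul_add] at hw ⊢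
      have := heval hh
      rw [re_ofReal_mul] at this
      nlinarith [(hg s).1, (hg s).2]
    · have : μ' s = μ s := by
        ext h
        simp [hμ', hout s hs]
      exact this ▸ hle s
  have hsup : ⨆ s : S, ‖μ' s‖ ≤ M := by
    have : Nonempty S := ⟨s₀⟩
    exact ciSup_le hnorm
  refine ⟨μ', U ∩ {s | M - r * ε < (μ' s 1).re}, hcont, hsup,
    hU.inter (isOpen_lt continuous_const (continuous_re.comp (hcont 1))), ⟨s₀, hs₀, ?_⟩,
    Set.inter_subset_left, fun s hs => ?_, ciSup_le fun s => ?_⟩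
  · have : (μ' s₀ 1).re = (μ s₀ f).re + (M - A) := by
      simp [hμ', hgs₀]
      ring
    rw [Set.mem_ofPred_eq, this]
    linarith
  · have : M - r * ε < (μ' s 1).re := hs.2
    linarith
  · have hsub : μ' s - μ s = (g s : ℂ) • ν s := add_sub_cancel_left _ _
    have hpos : 0 ≤ √(2 * M * ε) + 2 * ε := by positivity
    by_cases hs : s ∈ V
    · have hνs : ‖ν s‖ ≤ √(2 * M * ε) + 2 * ε := by
        refine ContinuousLinearMap.opNorm_le_of_re_le _ fun h hh => ?_
        have h1 := ContinuousMap.re_apply_sub_one_mul_le (μ s) (ε := ε) (hleA s hs.1)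
          (by linarith [hdef s hs.1]) hτ0 hτ1 hc0 hf hs.2.le hh
        have h2 : A * c / 2 ≤ M * c / 2 := by gcongr
        have h3 : (2 + 2 * A) * τ / c ≤ ε := by
          rw [div_le_iff₀ hc0]
          nlinarith
        rw [hν, add_re]
        linarith [heval hh]
      rw [hsub, norm_smul, norm_real, Real.norm_of_nonneg (hg s).1]
      nlinarith [(hg s).1, (hg s).2, norm_nonneg (ν s)]
    · rw [hsub, norm_smul, hout s hs]
      simpa using hpos
end

section
/- Let K and S be compact Hausdorff spaces and let C(K), C(S) denote the complex Banach spaces of continuous complex-valued functions with the supremum norm. Then the set of norm-attaining bounded linear operators from C(K) to C(S) is dense in L(C(K), C(S)) in the operator norm. -/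
section NormAttaining

variable {K S : Type*} [TopologicalSpace K] [CompactSpace K]
  [TopologicalSpace S] [CompactSpace S]

lemma Complex.exists_norm_one_mul_eq_norm (z : ℂ) : ∃ c : ℂ, ‖c‖ = 1 ∧ c * z = ‖z‖ := by
  by_cases hz : z = 0
  · exact ⟨1, by simp [hz]⟩
  · have h : (‖z‖ : ℂ) ≠ 0 := by simpa using hz
    refine ⟨‖z‖ / z, ?_, by field_simp⟩
    rw [norm_div, Complex.norm_real, norm_norm, div_self (by simpa using hz)]

lemma re_apply_le_opNorm_mul (T : C(K, ℂ) →L[ℂ] C(S, ℂ)) {f : C(K, ℂ)} {c : ℝ}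
    (hf : ‖f‖ ≤ c) (s : S) : (T f s).re ≤ ‖T‖ * c :=
  (Complex.re_le_norm _).trans (((T f).norm_coe_le_norm s).trans (T.le_opNorm_of_le hf))

lemma exists_lt_re_apply_of_lt_opNorm (T : C(K, ℂ) →L[ℂ] C(S, ℂ)) {r : ℝ} (hr : 0 ≤ r)
    (h : r < ‖T‖) : ∃ f : C(K, ℂ), ‖f‖ < 1 ∧ ∃ s, r < (T f s).re := by
  obtain ⟨f, hf, hTf⟩ := T.exists_lt_apply_of_lt_opNorm h
  obtain ⟨s, hs⟩ : ∃ s, r < ‖T f s‖ := by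
    by_contra! hc
    exact absurd ((ContinuousMap.norm_le _ hr).2 hc) (not_le.2 hTf)
  obtain ⟨c, hc, hcz⟩ := Complex.exists_norm_one_mul_eq_norm (T f s)
  refine ⟨c • f, by rwa [norm_smul, hc, one_mul], s, ?_⟩
  rw [map_smul, ContinuousMap.smul_apply, smul_eq_mul, hcz, Complex.ofReal_re]
  exact hs

/-- The sum of a unimodular function and a strict contraction is a sum of two unimodular
functions. -/
lemma exists_add_eq_add_unimodular {u f : C(K, ℂ)} (hu : ∀ x, ‖u x‖ = 1) (hf : ‖f‖ < 1) :
    ∃ v w : C(K, ℂ), (∀ x, ‖v x‖ = 1) ∧ (∀ x, ‖w x‖ = 1) ∧ v + w = u + f := by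
  have hfx : ∀ x, ‖f x‖ < 1 := fun x => (f.norm_coe_le_norm x).trans_lt hf
  have hne : ∀ x, u x + f x ≠ 0 := fun x h => by
    have h1 : ‖u x‖ = ‖f x‖ := by rw [eq_neg_of_add_eq_zero_left h, norm_neg]
    linarith [hfx x, hu x]
  have hpos : ∀ x, 0 < ‖u x + f x‖ := fun x => norm_pos_iff.2 (hne x)
  have hle : ∀ x, (‖u x + f x‖ / 2) ^ 2 ≤ 1 := fun x => by
    have := norm_add_le (u x) (f x)
    have := hpos x
    have := hfx x
    have := hu x
    nlinarith
  have key : ∀ x, ∀ ε : ℝ, ε ^ 2 = 1 → ‖(u x + f x) / ‖u x + f x‖ *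
      ((‖u x + f x‖ / 2 : ℝ) +
        ((ε * √(1 - (‖u x + f x‖ / 2) ^ 2) : ℝ) : ℂ) * Complex.I)‖ = 1 := by
    intro x ε hε
    rw [norm_mul, norm_div, Complex.norm_real, norm_norm, div_self (hpos x).ne', one_mul,
      Complex.norm_add_mul_I, mul_pow, hε, Real.sq_sqrt (by linarith [hle x])]
    simp
  have hcont : ∀ ε : ℝ, Continuous fun x => (u x + f x) / (‖u x + f x‖ : ℂ) *
      ((‖u x + f x‖ / 2 : ℝ) +
        ((ε * √(1 - (‖u x + f x‖ / 2) ^ 2) : ℝ) : ℂ) * Complex.I) := by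
    intro ε
    refine Continuous.mul (Continuous.div (by fun_prop) (by fun_prop) fun x => ?_) (by fun_prop)
    exact_mod_cast (hpos x).ne'
  refine ⟨⟨_, hcont 1⟩, ⟨_, hcont (-1)⟩, fun x => key x 1 (by norm_num),
    fun x => key x (-1) (by norm_num), ?_⟩
  ext x
  have h : (‖u x + f x‖ : ℂ) ≠ 0 := by exact_mod_cast (hpos x).ne'
  simp only [ContinuousMap.add_apply, ContinuousMap.coe_mk]
  push_cast
  field_simp
  ring

/-- The norm of an operator on `C(K, ℂ)` is approximated on unimodular functions. -/
lemma exists_unimodular_lt_re_apply (T : C(K, ℂ) →L[ℂ] C(S, ℂ)) {r : ℝ} (hr : 0 ≤ r)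
    (h : r < ‖T‖) : ∃ f : C(K, ℂ), (∀ x, ‖f x‖ = 1) ∧ ∃ s, r < (T f s).re := by
  obtain ⟨f, hf, s, hs⟩ := exists_lt_re_apply_of_lt_opNorm T hr h
  by_contra! hc
  set A : Set ℝ := {a | ∃ u : C(K, ℂ), (∀ x, ‖u x‖ = 1) ∧ (T u s).re = a}
  have hA : BddAbove A := ⟨r, by rintro _ ⟨u, hu, rfl⟩; exact hc u hu s⟩
  have hne : A.Nonempty := ⟨_, 1, by simp, rfl⟩
  have h1 : sSup A ≤ r := csSup_le hne (by rintro _ ⟨u, hu, rfl⟩; exact hc u hu s)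
  have h2 : sSup A ≤ 2 * sSup A - (T f s).re := by
    refine csSup_le hne ?_
    rintro _ ⟨u, hu, rfl⟩
    obtain ⟨v, w, hv, hw, hvw⟩ := exists_add_eq_add_unimodular hu hf
    have hv' := le_csSup hA ⟨v, hv, rfl⟩
    have hw' := le_csSup hA ⟨w, hw, rfl⟩
    have := congrArg (fun g => (T g s).re) hvw
    simp only [map_add, ContinuousMap.add_apply, Complex.add_re] at this
    linarith
  linarith

lemma half_norm_add_add_mul_norm_sub_le {p q : ℂ} (hp : ‖p‖ ≤ 1) (hq : ‖q‖ ≤ 1) (t : ℝ) :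
    ‖p + q‖ / 2 + t * ‖p - q‖ ≤ 1 + 2 * t ^ 2 := by
  have h := parallelogram_law_with_norm ℝ p q
  have hp' : ‖p‖ * ‖p‖ ≤ 1 := by nlinarith [norm_nonneg p]
  have hq' : ‖q‖ * ‖q‖ ≤ 1 := by nlinarith [norm_nonneg q]
  refine abs_le_of_sq_le_sq' ?_ (by positivity) |>.2
  have h4 : (‖p + q‖ ^ 2 + ‖p - q‖ ^ 2) * (1 + 4 * t ^ 2) ≤ 4 * (1 + 4 * t ^ 2) :=
    mul_le_mul_of_nonneg_right (by nlinarith) (by positivity)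
  nlinarith [sq_nonneg (t * ‖p + q‖ - ‖p - q‖ / 2), sq_nonneg (t ^ 2)]

/-- If an operator almost attains its norm at one point on two functions in the unit ball, then
it is small there on multiples of their difference. -/
lemma norm_apply_sub_mul_le (T : C(K, ℂ) →L[ℂ] C(S, ℂ)) {f₀ f₁ g : C(K, ℂ)} (h₀ : ‖f₀‖ ≤ 1)
    (h₁ : ‖f₁‖ ≤ 1) {t : ℝ} (ht : 0 < t) {s : S}
    (h : 2 * ‖T‖ - 6 * t ^ 2 < (T (f₀ + f₁) s).re) :
    ‖T ((f₀ - f₁) * g) s‖ ≤ (3 + 2 * ‖T‖) * t * ‖g‖ := by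
  rcases eq_or_ne g 0 with rfl | hg
  · simp
  have hg0 : 0 < ‖g‖ := norm_pos_iff.2 hg
  obtain ⟨c, hc, hcz⟩ := Complex.exists_norm_one_mul_eq_norm (T ((f₀ - f₁) * g) s)
  have hb : ‖((1 / 2 : ℝ) : ℂ) • (f₀ + f₁) + ((t / ‖g‖ : ℝ) * c) • ((f₀ - f₁) * g)‖
      ≤ 1 + 2 * t ^ 2 := by
    refine (ContinuousMap.norm_le _ (by positivity)).2 fun x => ?_
    refine le_trans ?_ (half_norm_add_add_mul_norm_sub_le ((f₀.norm_coe_le_norm x).trans h₀)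
      ((f₁.norm_coe_le_norm x).trans h₁) t)
    simp only [ContinuousMap.add_apply, ContinuousMap.smul_apply, ContinuousMap.mul_apply,
      ContinuousMap.sub_apply, smul_eq_mul]
    refine (norm_add_le _ _).trans (add_le_add ?_ ?_)
    · rw [norm_mul, Complex.norm_real, Real.norm_of_nonneg (by norm_num)]
      linarith
    · rw [norm_mul, norm_mul, norm_mul, hc, Complex.norm_real, Real.norm_of_nonneg (by positivity)]
      have := g.norm_coe_le_norm x
      calc t / ‖g‖ * 1 * (‖f₀ x - f₁ x‖ * ‖g x‖) ≤ t / ‖g‖ * 1 * (‖f₀ x - f₁ x‖ * ‖g‖) := by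
            gcongr
        _ = t * ‖f₀ x - f₁ x‖ := by field_simp
  have hT := re_apply_le_opNorm_mul T hb s
  rw [map_add, map_smul, map_smul, ContinuousMap.add_apply, ContinuousMap.smul_apply,
    ContinuousMap.smul_apply, smul_eq_mul, smul_eq_mul, mul_assoc, hcz, Complex.add_re,
    Complex.re_ofReal_mul, Complex.re_ofReal_mul, Complex.ofReal_re] at hT
  have h5 : t / ‖g‖ * ‖T ((f₀ - f₁) * g) s‖ ≤ t * ((3 + 2 * ‖T‖) * t) := by nlinarith
  rw [div_mul_eq_mul_div, mul_div_assoc] at h5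
  have h6 := le_of_mul_le_mul_left h5 ht
  rwa [div_le_iff₀ hg0] at h6

lemma exists_continuousMap_bump [T2Space S] {U : Set S} (hU : IsOpen U) {s : S} (hs : s ∈ U) :
    ∃ v : C(S, ℂ), v s = 1 ∧ (∀ x ∉ U, v x = 0) ∧
      ∀ x, ∃ a : ℝ, 0 ≤ a ∧ a ≤ 1 ∧ v x = a := by
  obtain ⟨v, h0, h1, h01⟩ := exists_continuous_zero_one_of_isClosed (hU.isClosed_compl)
    (isClosed_singleton (x := s)) (by simpa using hs)
  refine ⟨⟨fun x => (v x : ℂ), by fun_prop⟩, ?_, fun x hx => ?_, fun x =>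
    ⟨v x, (h01 x).1, (h01 x).2, rfl⟩⟩
  · simpa using h1 rfl
  · simpa using h0 hx

/-- An operator almost attaining its norm at a unimodular function `f₀` can be perturbed so that
every point where it almost attains its norm is a point where its value at `f₀` is large. -/
lemma exists_perturbation_localized [T2Space S] [Nonempty K] {f₀ : C(K, ℂ)}
    (hf₀ : ∀ x, ‖f₀ x‖ = 1) (T : C(K, ℂ) →L[ℂ] C(S, ℂ)) {δ : ℝ} (hδ : 0 < δ)
    (h : ∃ s, ‖T‖ - δ < (T f₀ s).re) :
    ∃ T' : C(K, ℂ) →L[ℂ] C(S, ℂ), ‖T' - T‖ ≤ 2 * δ ∧ ‖T‖ + δ < ‖T'‖ ∧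
      ∀ f : C(K, ℂ), ‖f‖ ≤ 1 → ∀ s, ‖T‖ < (T' f s).re → ‖T‖ - δ < (T' f₀ s).re := by
  obtain ⟨s₀, hs₀⟩ := h
  obtain ⟨k⟩ := ‹Nonempty K›
  obtain ⟨v, hv1, hv0, hv⟩ := exists_continuousMap_bump
    (U := {s | ‖T‖ - δ < (T f₀ s).re}) (isOpen_lt (by fun_prop) (by fun_prop)) hs₀
  have hf₀n : ‖f₀‖ ≤ 1 := (ContinuousMap.norm_le _ zero_le_one).2 fun x => (hf₀ x).le
  let ψ : C(K, ℂ) →L[ℂ] ℂ := (star (f₀ k)) • ContinuousMap.evalCLM ℂ k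
  have hψ : ψ f₀ = 1 := by
    change star (f₀ k) * f₀ k = 1
    rw [Complex.star_def, mul_comm, Complex.mul_conj, Complex.normSq_eq_norm_sq, hf₀]
    simp
  let T' := T + ((2 * δ : ℝ) : ℂ) • ψ.smulRight v
  have happ : ∀ g s, T' g s = T g s + (2 * δ : ℝ) * (ψ g * v s) := fun g s => rfl
  have hsub : ∀ g s, (T' - T) g s = (2 * δ : ℝ) * (ψ g * v s) := fun g s => by
    rw [sub_apply, ContinuousMap.sub_apply, happ]; ring
  have happ₀ : ∀ s, ∃ a : ℝ, 0 ≤ a ∧ a ≤ 1 ∧ v s = a ∧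
      (T' f₀ s).re = (T f₀ s).re + 2 * δ * a := fun s => by
    obtain ⟨a, ha0, ha1, ha⟩ := hv s
    refine ⟨a, ha0, ha1, ha, ?_⟩
    rw [happ, hψ, ha, one_mul, ← Complex.ofReal_mul, Complex.add_re, Complex.ofReal_re]
  refine ⟨T', ?_, ?_, fun f hf s hs => ?_⟩
  · refine ContinuousLinearMap.opNorm_le_bound _ (by positivity) fun g => ?_
    refine (ContinuousMap.norm_le _ (by positivity)).2 fun s => ?_
    obtain ⟨a, ha0, ha1, ha⟩ := hv s
    have h1 : ‖ψ g‖ ≤ ‖g‖ := by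
      change ‖star (f₀ k) * g k‖ ≤ _
      rw [norm_mul, norm_star, hf₀, one_mul]
      exact g.norm_coe_le_norm k
    rw [hsub, ha, norm_mul, norm_mul, Complex.norm_real, Complex.norm_real,
      Real.norm_of_nonneg ha0, Real.norm_of_nonneg (by positivity)]
    have : ‖ψ g‖ * a ≤ ‖g‖ * 1 := mul_le_mul h1 ha1 ha0 (norm_nonneg _)
    rw [mul_one] at this
    gcongr
  · obtain ⟨a, -, -, ha, hre⟩ := happ₀ s₀
    have ha1 : a = 1 := by exact_mod_cast ha.symm.trans hv1
    have := re_apply_le_opNorm_mul T' hf₀n s₀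
    rw [hre, ha1] at this
    linarith
  · by_cases hsU : ‖T‖ - δ < (T f₀ s).re
    · obtain ⟨a, ha0, -, -, hre⟩ := happ₀ s
      rw [hre]
      nlinarith
    · have := re_apply_le_opNorm_mul T hf s
      rw [happ, hv0 s hsU] at hs
      simp only [mul_zero, add_zero] at hs
      linarith

/-- If an operator almost attains its norm at the same point on a function `f₁` and on a
unimodular function `f₀`, then a small perturbation, not increasing the norm, gives `f₀` the
value that `f₁` had at that point. -/
lemma exists_phase_correction [T2Space S] {f₀ f₁ : C(K, ℂ)} (hf₀ : ∀ x, ‖f₀ x‖ = 1)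
    (hf₁ : ‖f₁‖ ≤ 1) (T : C(K, ℂ) →L[ℂ] C(S, ℂ)) {t : ℝ} (ht : 0 < t) {s₁ : S}
    (h : 2 * ‖T‖ - 6 * t ^ 2 < (T (f₀ + f₁) s₁).re) :
    ∃ T' : C(K, ℂ) →L[ℂ] C(S, ℂ), ‖T' - T‖ ≤ (3 + 2 * ‖T‖) * t ∧ ‖T'‖ ≤ ‖T‖ ∧
      T' f₀ s₁ = T f₁ s₁ := by
  have hf₀n : ‖f₀‖ ≤ 1 := (ContinuousMap.norm_le _ zero_le_one).2 fun x => (hf₀ x).le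
  have hstar : star f₀ * f₀ = 1 := by
    ext x
    change star (f₀ x) * f₀ x = 1
    rw [Complex.star_def, mul_comm, Complex.mul_conj, Complex.normSq_eq_norm_sq, hf₀]
    simp
  obtain ⟨u, hu1, hu0, hu⟩ := exists_continuousMap_bump
    (U := {s | 2 * ‖T‖ - 6 * t ^ 2 < (T (f₀ + f₁) s).re})
    (isOpen_lt (by fun_prop) (by fun_prop)) h
  let T' := T - (ContinuousLinearMap.mul ℂ C(S, ℂ) u).comp
    (T.comp (ContinuousLinearMap.mul ℂ C(K, ℂ) ((f₀ - f₁) * star f₀)))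
  have happ : ∀ g s, T' g s = T g s - u s * T ((f₀ - f₁) * star f₀ * g) s := fun g s => rfl
  refine ⟨T', ?_, ?_, ?_⟩
  · refine ContinuousLinearMap.opNorm_le_bound _ (by positivity) fun g => ?_
    refine (ContinuousMap.norm_le _ (by positivity)).2 fun s => ?_
    rw [sub_apply, ContinuousMap.sub_apply, happ, sub_sub_cancel_left,
      norm_neg, norm_mul]
    by_cases hs : 2 * ‖T‖ - 6 * t ^ 2 < (T (f₀ + f₁) s).re
    · obtain ⟨a, ha0, ha1, ha⟩ := hu s
      have h1 : ‖u s‖ ≤ 1 := by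
        rwa [ha, Complex.norm_real, Real.norm_of_nonneg ha0]
      have h2 : ‖star f₀ * g‖ ≤ ‖g‖ := by
        refine (norm_mul_le _ _).trans ?_
        rw [norm_star]
        exact mul_le_of_le_one_left (norm_nonneg _) hf₀n
      rw [mul_assoc]
      refine (mul_le_of_le_one_left (norm_nonneg _) h1).trans ?_
      exact (norm_apply_sub_mul_le T hf₀n hf₁ ht hs).trans (by gcongr)
    · rw [hu0 s hs, norm_zero, zero_mul]
      positivity
  · refine ContinuousLinearMap.opNorm_le_bound _ (by positivity) fun g => ?_
    refine (ContinuousMap.norm_le _ (by positivity)).2 fun s => ?_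
    obtain ⟨a, ha0, ha1, ha⟩ := hu s
    have h1 : T' g s = T (((1 : C(K, ℂ)) - (a : ℂ) • ((f₀ - f₁) * star f₀)) * g) s := by
      rw [happ, ha, sub_mul 1, one_mul, smul_mul_assoc, map_sub, map_smul,
        ContinuousMap.sub_apply, ContinuousMap.smul_apply, smul_eq_mul]
    have h2 : (1 : C(K, ℂ)) - (a : ℂ) • ((f₀ - f₁) * star f₀) =
        (((1 - a : ℝ) : ℂ) • f₀ + (a : ℂ) • f₁) * star f₀ := by
      rw [← hstar, sub_mul, add_mul, mul_comm (star f₀) f₀]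
      push_cast
      rw [smul_mul_assoc, smul_mul_assoc]
      module
    have h3 : ‖(((1 - a : ℝ) : ℂ) • f₀ + (a : ℂ) • f₁)‖ ≤ 1 := by
      refine (norm_add_le _ _).trans ?_
      rw [norm_smul, norm_smul, Complex.norm_real, Complex.norm_real,
        Real.norm_of_nonneg ha0, Real.norm_of_nonneg (by linarith)]
      nlinarith
    have h4 : ‖(((1 - a : ℝ) : ℂ) • f₀ + (a : ℂ) • f₁) * star f₀‖ ≤ 1 := by
      refine (norm_mul_le _ _).trans ?_
      rw [norm_star]
      exact mul_le_one₀ h3 (norm_nonneg _) hf₀n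
    rw [h1, h2]
    refine ((T _).norm_coe_le_norm s).trans (T.le_opNorm_of_le ?_)
    exact (norm_mul_le _ _).trans (mul_le_of_le_one_left (norm_nonneg _) h4)
  · rw [happ, hu1, mul_assoc, hstar, mul_one, map_sub, ContinuousMap.sub_apply]
    ring

lemma exists_defect_reduction [T2Space S] [Nonempty K] {f₀ : C(K, ℂ)}
    (hf₀ : ∀ x, ‖f₀ x‖ = 1) (T : C(K, ℂ) →L[ℂ] C(S, ℂ)) {B t : ℝ} (ht : 0 < t) (ht1 : t ≤ 1)
    (hB : ‖T‖ ≤ B - 4 * t) (h : ∃ s, ‖T‖ - t ^ 2 < (T f₀ s).re) :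
    ∃ T' : C(K, ℂ) →L[ℂ] C(S, ℂ), ‖T' - T‖ ≤ (5 + 2 * B) * t ∧ ‖T'‖ ≤ B - 4 * (t / 2) ∧
      ∃ s, ‖T'‖ - (t / 2) ^ 2 < (T' f₀ s).re := by
  obtain ⟨T₁, hd₁, hn₁, hloc⟩ := exists_perturbation_localized hf₀ T (pow_pos ht 2) h
  have htt : t ^ 2 ≤ t := by nlinarith
  have hT₁ : ‖T₁‖ ≤ ‖T‖ + 2 * t ^ 2 := by
    have := norm_le_norm_add_norm_sub' T₁ T
    linarith
  have ht2 : 0 < t ^ 2 := pow_pos ht 2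
  obtain ⟨f₁, hf₁, s₁, hs₁⟩ := exists_lt_re_apply_of_lt_opNorm T₁ (r := ‖T₁‖ - (t / 2) ^ 2)
    (by nlinarith [norm_nonneg T]) (by nlinarith)
  have hs₁' := hloc f₁ hf₁.le s₁ (by nlinarith)
  obtain ⟨T₂, hd₂, hn₂, he⟩ := exists_phase_correction hf₀ hf₁.le T₁ ht (s₁ := s₁) (by
    rw [map_add, ContinuousMap.add_apply, Complex.add_re]
    nlinarith)
  refine ⟨T₂, ?_, by linarith, s₁, by rw [he]; linarith⟩
  have h3 := norm_sub_le_norm_sub_add_norm_sub T₂ T₁ T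
  have h4 : (3 + 2 * ‖T₁‖) * t ≤ (3 + 2 * B) * t := by
    gcongr
    linarith
  linarith

lemma exists_normAttaining_near [T2Space S] [Nonempty K] {f₀ : C(K, ℂ)}
    (hf₀ : ∀ x, ‖f₀ x‖ = 1) (T : C(K, ℂ) →L[ℂ] C(S, ℂ)) {t : ℝ} (ht : 0 < t) (ht1 : t ≤ 1)
    (h : ∃ s, ‖T‖ - t ^ 2 < (T f₀ s).re) :
    ∃ R : C(K, ℂ) →L[ℂ] C(S, ℂ), ‖R f₀‖ = ‖R‖ ∧ dist T R ≤ (26 + 4 * ‖T‖) * t := by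
  have hf₀n : ‖f₀‖ ≤ 1 := (ContinuousMap.norm_le _ zero_le_one).2 fun x => (hf₀ x).le
  set B := ‖T‖ + 4 with hB
  let P : ℕ → (C(K, ℂ) →L[ℂ] C(S, ℂ)) → Prop := fun n A =>
    ‖A‖ ≤ B - 4 * (t / 2 ^ n) ∧ ∃ s, ‖A‖ - (t / 2 ^ n) ^ 2 < (A f₀ s).re
  have step : ∀ n A, P n A → ∃ A', P (n + 1) A' ∧ ‖A' - A‖ ≤ (5 + 2 * B) * (t / 2 ^ n) := by
    rintro n A ⟨h1, h2⟩
    have hle : t / 2 ^ n ≤ 1 := (div_le_self ht.le (one_le_pow₀ one_le_two)).trans ht1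
    obtain ⟨A', h3, h4, h5⟩ := exists_defect_reduction hf₀ A (by positivity) hle h1 h2
    refine ⟨A', ?_, h3⟩
    rw [div_div, ← pow_succ] at h4 h5
    exact ⟨h4, h5⟩
  choose! next hnext hdist using step
  let F : ℕ → (C(K, ℂ) →L[ℂ] C(S, ℂ)) := fun n => Nat.rec T (fun n A => next n A) n
  have hP : ∀ n, P n (F n) := fun n => by
    induction n with
    | zero =>
      change P 0 T
      simp only [P, pow_zero, div_one]
      exact ⟨by linarith, h⟩
    | succ n ih => exact hnext n _ ih
  have hF : ∀ n, dist (F n) (F (n + 1)) ≤ ((5 + 2 * B) * t * 2) / 2 / 2 ^ n := fun n => by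
    rw [dist_comm, dist_eq_norm]
    refine (hdist n _ (hP n)).trans (le_of_eq (by ring))
  obtain ⟨R, hR⟩ := cauchySeq_tendsto_of_complete (cauchySeq_of_le_geometric_two hF)
  refine ⟨R, le_antisymm (R.unit_le_opNorm f₀ hf₀n) ?_, ?_⟩
  · have h0 : Filter.Tendsto (fun n : ℕ => (t / 2 ^ n) ^ 2) Filter.atTop (nhds 0) := by
      have := (tendsto_const_nhds (x := t)).div_atTop
        (tendsto_pow_atTop_atTop_of_one_lt (one_lt_two (α := ℝ)))
      simpa using this.pow 2
    have h1 : Filter.Tendsto (fun n => F n f₀) Filter.atTop (nhds (R f₀)) :=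
      ((ContinuousLinearMap.apply ℂ C(S, ℂ) f₀).continuous.tendsto R).comp hR
    have h2 := hR.norm.sub h0
    rw [sub_zero] at h2
    refine le_of_tendsto_of_tendsto' h2 h1.norm fun n => ?_
    obtain ⟨-, s, hs⟩ := hP n
    exact hs.le.trans ((Complex.re_le_norm _).trans ((F n f₀).norm_coe_le_norm s))
  · refine (dist_le_of_le_geometric_two_of_tendsto₀ hF hR).trans (le_of_eq ?_)
    rw [hB]
    ring

end NormAttaining

/-- Complex Johnson–Wolfe theorem.  Let `K` and `S` be compact Hausdorff spaces and let
`C(K)`, `C(S)` denote the complex Banach spaces of continuous complex-valued functions with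
the supremum norm.  Then the set of norm-attaining bounded linear operators from `C(K)` to
`C(S)` is dense in `L(C(K), C(S))` in the operator norm. -/
theorem dense_norm_attaining_CK_CS
    {K S : Type*} [TopologicalSpace K] [CompactSpace K] [T2Space K]
    [TopologicalSpace S] [CompactSpace S] [T2Space S] :
    Dense {T : C(K, ℂ) →L[ℂ] C(S, ℂ) | ∃ f : C(K, ℂ), ‖f‖ ≤ 1 ∧ ‖T f‖ = ‖T‖} := by
  intro T
  rcases eq_or_ne T 0 with rfl | hT
  · exact subset_closure ⟨0, by simp⟩
  have hT0 : 0 < ‖T‖ := (norm_nonneg T).lt_of_ne' fun h => hT (T.opNorm_zero_iff.1 h)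
  have hK : Nonempty K := by
    by_contra hK
    rw [not_nonempty_iff] at hK
    refine hT (ContinuousLinearMap.ext fun f => ?_)
    rw [show f = 0 from ContinuousMap.ext fun x => isEmptyElim x, map_zero, map_zero]
  refine Metric.mem_closure_iff.2 fun ε hε => ?_
  set C := 26 + 4 * ‖T‖ with hC
  have hC0 : 0 < C := by positivity
  obtain ⟨t, ht, htm⟩ := exists_between
    (show 0 < min 1 (min ‖T‖ (ε / C)) from lt_min one_pos (lt_min hT0 (by positivity)))
  rw [lt_min_iff, lt_min_iff] at htm
  obtain ⟨f₀, hf₀, hs⟩ := exists_unimodular_lt_re_apply T (r := ‖T‖ - t ^ 2)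
    (by nlinarith) (by nlinarith)
  obtain ⟨R, hR, hd⟩ := exists_normAttaining_near hf₀ T ht htm.1.le hs
  refine ⟨R, ⟨f₀, (ContinuousMap.norm_le _ zero_le_one).2 fun x => (hf₀ x).le, hR⟩,
    hd.trans_lt ?_⟩
  have := (lt_div_iff₀ hC0).1 htm.2.2
  linarith
end
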